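/- arXiv:2505.22359 — 7 statements merged into one kernel-verified Lean document; each statement's English description precedes it below -/
import Mathlib

section
/- Let p ∈ [1,∞] and let f : ℝ^m → ℝ be a nonnegative differentiable function that is β-smooth with respect to the L_p norm. Then for every u, v ∈ ℝ^m, (f(u) − f(v))² ≤ 6β · max{f(u), f(v)} · ‖u − v‖_p². -/
open Real Filter MeasureTheory Finset
open scoped ENNReal

/-- The `L_p` norm of a vector in `ℝ^m`, for `p ∈ [1,∞]` (as an `ℝ≥0∞` parameter). -/
noncomputable def pnorm (p : ℝ≥0∞) {m : ℕ} (v : Fin m → ℝ) : ℝ :=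
  ‖(WithLp.equiv p (Fin m → ℝ)).symm v‖

/-- The gradient of `f : ℝ^m → ℝ`, as the vector of partial derivatives. -/
noncomputable def grad {m : ℕ} (f : (Fin m → ℝ) → ℝ) (w : Fin m → ℝ) : Fin m → ℝ :=
  fun i => fderiv ℝ f w (Pi.single i 1)


lemma holder_one_top {m : ℕ} (a d : Fin m → ℝ) :
    |∑ i, a i * d i| ≤ pnorm 1 a * pnorm ⊤ d := by
  have h1 : pnorm 1 a = ∑ i, |a i| := by
    simp [pnorm, PiLp.norm_eq_of_L1]
  have h2 : ∀ i, |d i| ≤ pnorm ⊤ d := by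
    intro i
    exact PiLp.norm_apply_le ((WithLp.equiv ⊤ (Fin m → ℝ)).symm d) i
  rw [h1, Finset.sum_mul]
  refine (Finset.abs_sum_le_sum_abs _ _).trans (Finset.sum_le_sum fun i _ => ?_)
  rw [abs_mul]
  exact mul_le_mul_of_nonneg_left (h2 i) (abs_nonneg _)

lemma holder_pq {m : ℕ} (p q : ℝ≥0∞) (hp : 1 ≤ p) (hpq : 1 / p + 1 / q = 1)
    (a d : Fin m → ℝ) :
    |∑ i, a i * d i| ≤ pnorm q a * pnorm p d := by
  by_cases hpt : p = ⊤
  · subst hpt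
    have : q = 1 := by simpa using hpq
    subst this
    exact holder_one_top a d
  by_cases hqt : q = ⊤
  · subst hqt
    have : p = 1 := by simpa using hpq
    subst this
    have := holder_one_top d a
    simpa only [mul_comm] using this
  have hp0 : p ≠ 0 := fun h => by simp [h] at hp
  have hq0 : q ≠ 0 := fun h => by simp [h] at hpq
  have hpr : 0 < p.toReal := ENNReal.toReal_pos hp0 hpt
  have hqr : 0 < q.toReal := ENNReal.toReal_pos hq0 hqt
  have hc : q.toReal.HolderConjugate p.toReal := by
    have h := congrArg ENNReal.toReal hpq
    rw [ENNReal.toReal_add (by simpa using hp0) (by simpa using hq0)] at h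
    simp at h
    exact ⟨by simp; linarith, hqr, hpr⟩
  have h := Real.inner_le_Lp_mul_Lq Finset.univ (fun i => |a i|) (fun i => |d i|) hc
  have e1 : pnorm q a = (∑ i, |a i| ^ q.toReal) ^ (1 / q.toReal) := by
    simp [pnorm, PiLp.norm_eq_sum hqr]
  have e2 : pnorm p d = (∑ i, |d i| ^ p.toReal) ^ (1 / p.toReal) := by
    simp [pnorm, PiLp.norm_eq_sum hpr]
  simp only [abs_abs] at h
  rw [e1, e2]
  refine le_trans (Finset.abs_sum_le_sum_abs _ _) ?_
  simpa only [abs_mul] using h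

lemma pnorm_smul {m : ℕ} (p : ℝ≥0∞) (hp : 1 ≤ p) (t : ℝ) (d : Fin m → ℝ) :
    pnorm p (t • d) = |t| * pnorm p d := by
  haveI : Fact (1 ≤ p) := ⟨hp⟩
  have := norm_smul t ((WithLp.equiv p (Fin m → ℝ)).symm d)
  simpa [pnorm] using this

lemma one_dim_aux (g g' : ℝ → ℝ) (L : ℝ) (hg : ∀ t, HasDerivAt g (g' t) t)
    (h0 : ∀ t, 0 ≤ g t) (hL : ∀ s t, |g' t - g' s| ≤ L * |t - s|) (s t : ℝ)
    (hst : |s - t| = 1) (hle : g t ≤ g s) :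
    (g s - g t) ^ 2 ≤ 6 * L * g s := by
  have hL0 : 0 ≤ L := by
    have := (abs_nonneg _).trans (hL 0 1)
    simpa using this
  have mv : ∀ a b, |g b - g a - g' a * (b - a)| ≤ L * (b - a) ^ 2 := by
    intro a b
    have key : ∃ c, |c - a| ≤ |b - a| ∧ g b - g a = g' c * (b - a) := by
      rcases lt_trichotomy a b with h | h | h
      · obtain ⟨c, hc, he⟩ := exists_hasDerivAt_eq_slope g g' h
          (fun x _ => (hg x).continuousAt.continuousWithinAt) (fun x _ => hg x)
        refine ⟨c, ?_, ?_⟩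
        · rw [abs_of_pos (by linarith [hc.1]), abs_of_pos (by linarith)]
          linarith [hc.2]
        · rw [he, div_mul_cancel₀ _ (by linarith)]
      · exact ⟨a, by simp, by simp [h]⟩
      · obtain ⟨c, hc, he⟩ := exists_hasDerivAt_eq_slope g g' h
          (fun x _ => (hg x).continuousAt.continuousWithinAt) (fun x _ => hg x)
        refine ⟨c, ?_, ?_⟩
        · rw [abs_of_neg (by linarith [hc.2]), abs_of_neg (by linarith)]
          linarith [hc.1]
        · have : g' c * (a - b) = g a - g b := by
            rw [he, div_mul_cancel₀ _ (by linarith)]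
          linarith
    obtain ⟨c, hc, he⟩ := key
    rw [he, ← sub_mul, abs_mul, ← sq_abs (b - a), sq, ← mul_assoc]
    refine mul_le_mul_of_nonneg_right ?_ (abs_nonneg _)
    exact (hL a c).trans (mul_le_mul_of_nonneg_left hc hL0)
  have hd : (g' s) ^ 2 ≤ 4 * L * g s := by
    have := discrim_le_zero (a := L) (b := g' s) (c := g s) (by
      intro x
      have h1 := (abs_le.1 (mv s (s + x))).2
      have h2 := h0 (s + x)
      have e : s + x - s = x := by ring
      rw [e] at h1
      nlinarith)
    unfold discrim at this
    linarith
  have h1 := (abs_le.1 (mv s t)).1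
  have h2 : (t - s) ^ 2 = 1 := by rw [← sq_abs, abs_sub_comm, hst]; norm_num
  rw [h2] at h1
  have hgt := h0 t
  have hgs := h0 s
  by_cases hM : g s ≤ 6 * L
  · nlinarith
  · push Not at hM
    set x := g' s * (s - t) with hx
    have hx2 : x ^ 2 ≤ 4 * L * g s := by
      have : x ^ 2 = g' s ^ 2 * (t - s) ^ 2 := by rw [hx]; ring
      rw [this, h2]; linarith
    have hD : g s - g t ≤ x + L := by rw [hx]; linarith
    have hD2 : (g s - g t) ^ 2 ≤ (x + L) ^ 2 := pow_le_pow_left₀ (by linarith) hD 2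
    nlinarith [sq_nonneg (x - 4 * L), mul_nonneg hL0 hgs, mul_nonneg hL0 (sub_nonneg.2 hM.le)]

/-- if `f : ℝ^m → ℝ` is nonnegative, differentiable and `β`-smooth w.r.t. the
`L_p` norm (`1/p + 1/q = 1`), then `(f(u) - f(v))² ≤ 6 β max{f(u), f(v)} ‖u - v‖_p²`. -/
theorem statement1 {m : ℕ} (p q : ℝ≥0∞) (hp : 1 ≤ p) (hpq : 1 / p + 1 / q = 1)
    (β : ℝ) (f : (Fin m → ℝ) → ℝ)
    (hdiff : Differentiable ℝ f)
    (hnonneg : ∀ w, 0 ≤ f w)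
    (hsmooth : ∀ u v, pnorm q (grad f v - grad f u) ≤ β * pnorm p (v - u)) :
    ∀ u v, (f u - f v) ^ 2 ≤ 6 * β * max (f u) (f v) * pnorm p (u - v) ^ 2 := by
  intro u v
  set d := u - v with hd
  have hgr : ∀ w, fderiv ℝ f w d = ∑ i, grad f w i * d i := by
    intro w
    conv_lhs => rw [← Finset.univ_sum_single d]
    rw [map_sum]
    refine Finset.sum_congr rfl fun i _ => ?_
    have : (Pi.single i (d i) : Fin m → ℝ) = d i • Pi.single i (1 : ℝ) := by
      rw [← Pi.single_smul]; simp
    rw [this, map_smul, smul_eq_mul, mul_comm]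
    rfl
  have hder : ∀ t : ℝ, HasDerivAt (fun t : ℝ => f (v + t • d)) (fderiv ℝ f (v + t • d) d) t := by
    intro t
    have h1 : HasDerivAt (fun t : ℝ => v + t • d) d t := by
      simpa using ((hasDerivAt_id t).smul_const d).const_add v
    exact (hdiff (v + t • d)).hasFDerivAt.comp_hasDerivAt t h1
  have hLip : ∀ s t : ℝ, |fderiv ℝ f (v + t • d) d - fderiv ℝ f (v + s • d) d|
      ≤ (β * pnorm p d ^ 2) * |t - s| := by
    intro s t
    have h1 := holder_pq p q hp hpq (grad f (v + t • d) - grad f (v + s • d)) d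
    have h2 := hsmooth (v + s • d) (v + t • d)
    have e : v + t • d - (v + s • d) = (t - s) • d := by rw [sub_smul]; abel
    rw [e, pnorm_smul p hp] at h2
    have hn : 0 ≤ pnorm p d := by
      haveI : Fact (1 ≤ p) := ⟨hp⟩
      exact norm_nonneg _
    rw [hgr, hgr, ← Finset.sum_sub_distrib]
    simp only [Pi.sub_apply, sub_mul] at h1
    have h3 := mul_le_mul_of_nonneg_right h2 hn
    refine h1.trans (h3.trans (le_of_eq ?_))
    ring
  have key := one_dim_aux _ _ _ hder (fun t => hnonneg _) hLip
  have e0 : v + (0 : ℝ) • d = v := by simp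
  have e1 : v + (1 : ℝ) • d = u := by simp [hd]
  rcases le_total (f v) (f u) with h | h
  · have := key 1 0 (by simp) (by simpa only [e0, e1] using h)
    simp only [e0, e1] at this
    rw [max_eq_left h]
    linarith
  · have := key 0 1 (by simp) (by simpa only [e0, e1] using h)
    simp only [e0, e1] at this
    rw [max_eq_right h]
    linarith [sq_nonneg (f u - f v), (by ring : (f u - f v) ^ 2 = (f v - f u) ^ 2)]
end

section
/- Let k ≥ 2, p ∈ [2,∞], and let ℓ̃ : ℝ^{k−1} → ℝ be differentiable and β-smooth with respect to the L_p norm. Fix y ∈ {1,…,k} and x ∈ ℝ^d with ‖x‖₂ ≤ 1, and define ℓ_{(x,y)} : ℝ^{k×d} → ℝ by ℓ_{(x,y)}(W) = ℓ̃(D_y W x). Then for all W, W′ ∈ ℝ^{k×d}, ‖∇ℓ_{(x,y)}(W) − ∇ℓ_{(x,y)}(W′)‖_F ≤ 3 β k^{2/p} ‖W − W′‖_F, where the gradient is taken with respect to W and ‖·‖_F is the Frobenius norm. -/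
open Real Filter MeasureTheory Finset
open scoped ENNReal

/-- The Frobenius norm of a `k × d` matrix. -/
noncomputable def frob {k d : ℕ} (A : Fin k → Fin d → ℝ) : ℝ :=
  Real.sqrt (∑ i, ∑ j, A i j ^ 2)

/-- The gradient of a function of a `k × d` matrix, as the matrix of partial derivatives. -/
noncomputable def gradM {k d : ℕ} (f : (Fin k → Fin d → ℝ) → ℝ) (W : Fin k → Fin d → ℝ) :
    Fin k → Fin d → ℝ :=
  fun i j => fderiv ℝ f W (Pi.single i (Pi.single j 1))

/-- The increasing enumeration of `{0, …, k-1} \ {y}` by `Fin (k-1)`. -/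
def skipIdx {k : ℕ} (y : Fin k) (j : Fin (k - 1)) : Fin k :=
  if (j : ℕ) < (y : ℕ) then ⟨j, by have := j.isLt; omega⟩
  else ⟨(j : ℕ) + 1, by have := j.isLt; omega⟩

/-- The linear map `D_y : ℝ^k → ℝ^{k-1}` sending `v` to the vector `(v_y - v_j)_{j ≠ y}`. -/
def Dmap {k : ℕ} (y : Fin k) (v : Fin k → ℝ) : Fin (k - 1) → ℝ :=
  fun j => v y - v (skipIdx y j)


lemma aux_pnorm_real {p : ℝ≥0∞} (hp : 0 < p.toReal) {m : ℕ} (v : Fin m → ℝ) :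
    pnorm p v = (∑ i, |v i| ^ p.toReal) ^ (1 / p.toReal) := by
  unfold pnorm
  rw [PiLp.norm_eq_sum hp]
  rfl

lemma aux_pnorm_top {m : ℕ} (v : Fin m → ℝ) : pnorm ∞ v = ‖v‖ := by
  unfold pnorm
  exact PiLp.norm_toLp v

lemma aux_pnorm_two {m : ℕ} (v : Fin m → ℝ) : pnorm 2 v = √(∑ i, v i ^ 2) := by
  unfold pnorm
  rw [PiLp.norm_eq_of_L2]
  simp

lemma aux_toReal {p : ℝ≥0∞} (hp : 2 ≤ p) (ht : p ≠ ∞) : 2 ≤ p.toReal := by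
  have := ENNReal.toReal_mono ht hp
  simpa using this

lemma aux_le_two {p : ℝ≥0∞} (hp : 2 ≤ p) {m : ℕ} (v : Fin m → ℝ) :
    pnorm p v ≤ √(∑ i, v i ^ 2) := by
  set S := √(∑ i, v i ^ 2) with hS
  have hS0 : 0 ≤ S := Real.sqrt_nonneg _
  have hS2 : S ^ 2 = ∑ i, v i ^ 2 := Real.sq_sqrt (Finset.sum_nonneg fun i _ => sq_nonneg _)
  have hv : ∀ i, |v i| ≤ S := by
    intro i
    apply Real.abs_le_sqrt
    exact Finset.single_le_sum (f := fun i => v i ^ 2) (fun i _ => sq_nonneg _) (Finset.mem_univ i)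
  by_cases ht : p = ∞
  · subst ht
    rw [aux_pnorm_top]
    exact (pi_norm_le_iff_of_nonneg hS0).2 hv
  · have h2 := aux_toReal hp ht
    have h0 : 0 < p.toReal := by linarith
    rw [aux_pnorm_real h0]
    set r := p.toReal
    have key : ∀ z : ℝ, 0 ≤ z → z ^ r = z ^ 2 * z ^ (r - 2) := by
      intro z hz
      rw [← Real.rpow_natCast z 2, ← Real.rpow_add_of_nonneg hz (by norm_num) (by linarith)]
      congr 1
      push_cast
      ring
    have h : ∑ i, |v i| ^ r ≤ S ^ r := by
      rw [key S hS0, hS2, Finset.sum_mul]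
      apply Finset.sum_le_sum
      intro i _
      rw [key _ (abs_nonneg _), sq_abs]
      exact mul_le_mul_of_nonneg_left
        (Real.rpow_le_rpow (abs_nonneg _) (hv i) (by linarith)) (sq_nonneg _)
    calc _ ≤ (S ^ r) ^ (1 / r) := by
          apply Real.rpow_le_rpow _ h (by positivity)
          exact Finset.sum_nonneg fun i _ => Real.rpow_nonneg (abs_nonneg _) _
      _ = S := by
          rw [← Real.rpow_mul hS0, mul_one_div_cancel h0.ne', Real.rpow_one]

lemma aux_holder {p q : ℝ≥0∞} (hp : 2 ≤ p) (hpq : 1 / p + 1 / q = 1) {m : ℕ}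
    (g h : Fin m → ℝ) : ∑ i, g i * h i ≤ pnorm q g * pnorm p h := by
  rw [one_div, one_div] at hpq
  by_cases ht : p = ∞
  · subst ht
    have hq : q = 1 := by simpa using hpq
    subst hq
    rw [aux_pnorm_top, aux_pnorm_real (by simp)]
    simp only [ENNReal.toReal_one, Real.rpow_one, div_one]
    rw [Finset.sum_mul]
    apply Finset.sum_le_sum
    intro i _
    calc g i * h i ≤ |g i * h i| := le_abs_self _
      _ = |g i| * |h i| := abs_mul _ _
      _ ≤ _ := mul_le_mul_of_nonneg_left (norm_le_pi_norm h i) (abs_nonneg _)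
  · have h2 := aux_toReal hp ht
    have : ENNReal.HolderConjugate p q := ENNReal.holderConjugate_iff.2 hpq
    have hc : p.toReal.HolderConjugate q.toReal :=
      ENNReal.HolderConjugate.toReal (by linarith)
    rw [aux_pnorm_real hc.symm.pos, aux_pnorm_real hc.pos]
    exact Real.inner_le_Lp_mul_Lq _ _ _ hc.symm

lemma aux_pnorm_add {p : ℝ≥0∞} (hp : 2 ≤ p) {m : ℕ} (u v : Fin m → ℝ) :
    pnorm p (u - v) ≤ pnorm p u + pnorm p v := by
  have : Fact (1 ≤ p) := ⟨le_trans (by norm_num) hp⟩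
  exact norm_sub_le (WithLp.toLp p u) (WithLp.toLp p v)

lemma aux_pnorm_const {p : ℝ≥0∞} (hp : 2 ≤ p) {m : ℕ} (a : ℝ) :
    pnorm p (fun _ : Fin m => a) ≤ |a| * ((m + 1 : ℕ) : ℝ) ^ (1 / p.toReal) := by
  by_cases ht : p = ∞
  · subst ht
    rw [aux_pnorm_top]
    simp only [ENNReal.toReal_top, div_zero, Real.rpow_zero, mul_one]
    exact (pi_norm_le_iff_of_nonneg (abs_nonneg a)).2 fun _ => le_rfl
  · have h2 := aux_toReal hp ht
    have h0 : 0 < p.toReal := by linarith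
    rw [aux_pnorm_real h0]
    simp only [Finset.sum_const, Finset.card_univ, Fintype.card_fin, nsmul_eq_mul]
    rw [Real.mul_rpow (by positivity) (by positivity), ← Real.rpow_mul (abs_nonneg _),
      mul_one_div_cancel h0.ne', Real.rpow_one, mul_comm]
    apply mul_le_mul_of_nonneg_left _ (abs_nonneg _)
    apply Real.rpow_le_rpow (by positivity) _ (by positivity)
    push_cast
    linarith

lemma aux_skip {n : ℕ} (y : Fin (n + 1)) (j : Fin n) :
    skipIdx (k := n + 1) y j = y.succAbove j := by
  unfold skipIdx
  ext
  simp only [Fin.succAbove, Fin.lt_def, Fin.val_castSucc]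
  split_ifs <;> simp

lemma aux_D {p : ℝ≥0∞} (hp : 2 ≤ p) {k : ℕ} (y : Fin k) (v : Fin k → ℝ) :
    pnorm p (Dmap y v) ≤ √2 * (k : ℝ) ^ (1 / p.toReal) * √(∑ i, v i ^ 2) := by
  obtain _ | n := k
  · exact y.elim0
  set K : ℝ := ((n + 1 : ℕ) : ℝ) ^ (1 / p.toReal) with hK
  have hK1 : 1 ≤ K := Real.one_le_rpow (by push_cast; linarith [Nat.cast_nonneg (α := ℝ) n])
    (by positivity)
  have e : Dmap y v = (fun _ : Fin n => v y) - (fun j : Fin n => v (y.succAbove j)) := by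
    funext j
    simp only [Dmap, Pi.sub_apply]
    rw [aux_skip]
  have h1 := aux_pnorm_add hp (fun _ : Fin n => v y) (fun j : Fin n => v (y.succAbove j))
  have h2 := aux_pnorm_const hp (m := n) (v y)
  have h3 := aux_le_two hp (fun j : Fin n => v (y.succAbove j))
  rw [← hK] at h2
  rw [Fin.sum_univ_succAbove _ y]
  have hR : 0 ≤ ∑ j : Fin n, v (y.succAbove j) ^ 2 := Finset.sum_nonneg fun i _ => sq_nonneg _
  set R := ∑ j : Fin n, v (y.succAbove j) ^ 2
  have h4 : |v y| + √R ≤ √2 * √(v y ^ 2 + R) := by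
    rw [← Real.sqrt_mul (by norm_num)]
    apply Real.le_sqrt_of_sq_le
    nlinarith [sq_nonneg (|v y| - √R), Real.sq_sqrt hR, sq_abs (v y)]
  calc pnorm p (Dmap y v) = _ := congrArg _ e
    _ ≤ |v y| * K + √R := by linarith
    _ ≤ K * (|v y| + √R) := by nlinarith [Real.sqrt_nonneg R]
    _ ≤ K * (√2 * √(v y ^ 2 + R)) := mul_le_mul_of_nonneg_left h4 (by linarith)
    _ = _ := by ring

/-- The linear map `V ↦ D_y V x`. -/
noncomputable def auxL {k d : ℕ} (y : Fin k) (x : Fin d → ℝ) :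
    (Fin k → Fin d → ℝ) →ₗ[ℝ] (Fin (k - 1) → ℝ) where
  toFun V := Dmap y (fun i => ∑ t, V i t * x t)
  map_add' V V' := by
    funext j
    simp only [Dmap, Pi.add_apply, add_mul, Finset.sum_add_distrib]
    ring
  map_smul' c V := by
    funext j
    simp only [Dmap, Pi.smul_apply, smul_eq_mul, mul_assoc, ← Finset.mul_sum, RingHom.id_apply]
    ring

lemma aux_gradM {k d : ℕ} (ltil : (Fin (k - 1) → ℝ) → ℝ) (hdiff : Differentiable ℝ ltil)
    (y : Fin k) (x : Fin d → ℝ) (W : Fin k → Fin d → ℝ) (i : Fin k) (j : Fin d) :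
    gradM (fun V => ltil (Dmap y (fun i => ∑ t, V i t * x t))) W i j =
      (∑ l, grad ltil (auxL y x W) l * Dmap y (Pi.single i 1) l) * x j := by
  unfold gradM
  set L := LinearMap.toContinuousLinearMap (auxL y x) with hL
  have h : HasFDerivAt (fun V : Fin k → Fin d → ℝ => ltil (Dmap y (fun i => ∑ t, V i t * x t)))
      ((fderiv ℝ ltil (auxL y x W)).comp L) W := by
    have h1 : HasFDerivAt ltil (fderiv ℝ ltil (L W)) (L W) := (hdiff _).hasFDerivAt
    exact h1.comp W L.hasFDerivAt
  rw [h.fderiv]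
  have e : L (Pi.single i (Pi.single j 1)) = x j • Dmap y (Pi.single i 1) := by
    have e1 : (fun a => ∑ t, (Pi.single i (Pi.single j 1) : Fin k → Fin d → ℝ) a t * x t)
        = fun a => x j * (Pi.single i 1 : Fin k → ℝ) a := by
      funext a
      by_cases ha : a = i
      · subst ha
        simp [Pi.single_apply]
      · simp [ha]
    change Dmap y (fun a => ∑ t, (Pi.single i (Pi.single j 1) : Fin k → Fin d → ℝ) a t * x t) = _
    rw [e1]
    funext l
    simp only [Dmap, Pi.smul_apply, smul_eq_mul]
    ring
  rw [ContinuousLinearMap.comp_apply, e, map_smul, smul_eq_mul, mul_comm]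
  congr 1
  have e2 := pi_eq_sum_univ' (Dmap y (Pi.single i (1 : ℝ)))
  conv_lhs => rw [e2, map_sum]
  apply Finset.sum_congr rfl
  intro l _
  rw [map_smul, smul_eq_mul, mul_comm]
  congr 2

/-- if the template `ℓ̃ : ℝ^{k-1} → ℝ` is differentiable and `β`-smooth w.r.t.
the `L_p` norm (`p ∈ [2,∞]`, `1/p + 1/q = 1`), `y ∈ [k]` and `‖x‖₂ ≤ 1`, then the gradient of
the loss `W ↦ ℓ̃(D_y W x)` is `3 β k^{2/p}`-Lipschitz in the Frobenius norm. -/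
theorem statement2 {k d : ℕ} (hk : 2 ≤ k)
    (p q : ℝ≥0∞) (hp : 2 ≤ p) (hpq : 1 / p + 1 / q = 1)
    (β : ℝ) (ltil : (Fin (k - 1) → ℝ) → ℝ)
    (hdiff : Differentiable ℝ ltil)
    (hsmooth : ∀ u v, pnorm q (grad ltil u - grad ltil v) ≤ β * pnorm p (u - v))
    (y : Fin k) (x : Fin d → ℝ) (hx : pnorm 2 x ≤ 1) :
    ∀ W W' : Fin k → Fin d → ℝ,
      frob (gradM (fun V => ltil (Dmap y (fun i => ∑ t, V i t * x t))) W -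
            gradM (fun V => ltil (Dmap y (fun i => ∑ t, V i t * x t))) W') ≤
        3 * β * (k : ℝ) ^ (2 / p.toReal) * frob (W - W') := by
  intro W W'
  set K : ℝ := (k : ℝ) ^ (1 / p.toReal) with hK
  have hK0 : 0 ≤ K := by positivity
  have hKK : (k : ℝ) ^ (2 / p.toReal) = K ^ 2 := by
    rw [hK, ← Real.rpow_natCast, ← Real.rpow_mul (by positivity)]
    congr 1
    push_cast
    ring
  have hpn : ∀ {m : ℕ} (v : Fin m → ℝ), 0 ≤ pnorm p v := by
    intro m v
    have : Fact (1 ≤ p) := ⟨le_trans (by norm_num) hp⟩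
    exact norm_nonneg (WithLp.toLp p v)
  have hq1 : 1 ≤ q := by
    have : 1 / q ≤ 1 := by
      calc 1 / q ≤ 1 / p + 1 / q := le_add_self
        _ = 1 := hpq
    rw [one_div] at this
    exact ENNReal.inv_le_one.1 this
  have hqn : ∀ {m : ℕ} (v : Fin m → ℝ), 0 ≤ pnorm q v := by
    intro m v
    have : Fact (1 ≤ q) := ⟨hq1⟩
    exact norm_nonneg (WithLp.toLp q v)
  -- `β` is nonnegative
  have hβ : 0 ≤ β := by
    have h1 := hsmooth (Pi.single ⟨0, by omega⟩ 1) 0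
    have h2 : pnorm p ((Pi.single ⟨0, by omega⟩ 1 : Fin (k - 1) → ℝ) - 0) = 1 := by
      have : Fact (1 ≤ p) := ⟨le_trans (by norm_num) hp⟩
      rw [sub_zero]
      have := PiLp.norm_toLp_single p (fun _ : Fin (k - 1) => ℝ) ⟨0, by omega⟩ (1 : ℝ)
      rw [norm_one] at this
      exact this
    rw [h2, mul_one] at h1
    exact le_trans (hqn _) h1
  have hx2 : ∑ t, x t ^ 2 ≤ 1 := by
    rw [aux_pnorm_two] at hx
    exact by simpa using (Real.sqrt_le_left (zero_le_one)).1 hx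
  have hx0 : 0 ≤ ∑ t, x t ^ 2 := Finset.sum_nonneg fun i _ => sq_nonneg _
  set g := grad ltil (auxL y x W) - grad ltil (auxL y x W') with hg
  set c : Fin k → ℝ := fun i => ∑ l, g l * Dmap y (Pi.single i 1) l with hc
  set S := ∑ i, c i ^ 2 with hS
  have hS0 : 0 ≤ S := Finset.sum_nonneg fun i _ => sq_nonneg _
  -- the left-hand side
  have hL : frob (gradM (fun V => ltil (Dmap y (fun i => ∑ t, V i t * x t))) W -
            gradM (fun V => ltil (Dmap y (fun i => ∑ t, V i t * x t))) W') ≤ √S := by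
    unfold frob
    apply Real.sqrt_le_sqrt
    rw [hS]
    apply Finset.sum_le_sum
    intro i _
    have : ∀ j, (gradM (fun V => ltil (Dmap y (fun i => ∑ t, V i t * x t))) W -
            gradM (fun V => ltil (Dmap y (fun i => ∑ t, V i t * x t))) W') i j = c i * x j := by
      intro j
      rw [Pi.sub_apply, Pi.sub_apply, aux_gradM ltil hdiff, aux_gradM ltil hdiff, ← sub_mul,
        ← Finset.sum_sub_distrib]
      simp only [hc, hg, Pi.sub_apply, sub_mul]
    simp only [this, mul_pow, ← Finset.mul_sum]
    nlinarith [sq_nonneg (c i)]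
  -- duality
  have hdual : S = ∑ l, g l * Dmap y c l := by
    have e : ∀ l, Dmap y c l = ∑ i, c i * Dmap y (Pi.single i 1) l := by
      intro l
      simp [Dmap, mul_sub, Finset.sum_sub_distrib, Pi.single_apply]
    simp only [e, Finset.mul_sum]
    rw [Finset.sum_comm, hS]
    apply Finset.sum_congr rfl
    intro i _
    rw [sq]
    nth_rewrite 2 [hc]
    rw [Finset.mul_sum]
    apply Finset.sum_congr rfl
    intro l _
    ring
  have h1 : S ≤ pnorm q g * (√2 * K * √S) := by
    calc S = _ := hdual
      _ ≤ pnorm q g * pnorm p (Dmap y c) := aux_holder hp hpq _ _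
      _ ≤ _ := mul_le_mul_of_nonneg_left (aux_D hp y c) (hqn _)
  have h2 : √S ≤ √2 * K * pnorm q g := by
    rcases hS0.eq_or_lt with h | h
    · rw [← h, Real.sqrt_zero]
      have := hqn g
      positivity
    · have hs : 0 < √S := Real.sqrt_pos.2 h
      refine le_of_mul_le_mul_right ?_ hs
      rw [Real.mul_self_sqrt hS0]
      linarith
  have h3 : pnorm q g ≤ β * (√2 * K * frob (W - W')) := by
    refine (hsmooth _ _).trans (mul_le_mul_of_nonneg_left ?_ hβ)
    have e : auxL y x W - auxL y x W' = Dmap y (fun i => ∑ t, (W - W') i t * x t) :=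
      (map_sub (auxL y x) W W').symm
    rw [e]
    refine (aux_D hp y _).trans ?_
    apply mul_le_mul_of_nonneg_left _ (by positivity)
    unfold frob
    apply Real.sqrt_le_sqrt
    apply Finset.sum_le_sum
    intro i _
    refine (Finset.sum_mul_sq_le_sq_mul_sq _ _ _).trans ?_
    have : 0 ≤ ∑ t, (W - W') i t ^ 2 := Finset.sum_nonneg fun i _ => sq_nonneg _
    nlinarith
  have hF : 0 ≤ frob (W - W') := Real.sqrt_nonneg _
  have h22 : √2 * √2 = (2 : ℝ) := Real.mul_self_sqrt (by norm_num)
  rw [hKK]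
  calc _ ≤ √2 * K * pnorm q g := hL.trans h2
    _ ≤ √2 * K * (β * (√2 * K * frob (W - W'))) :=
        mul_le_mul_of_nonneg_left h3 (by positivity)
    _ = (√2 * √2) * (β * K ^ 2 * frob (W - W')) := by ring
    _ = 2 * (β * K ^ 2 * frob (W - W')) := by rw [h22]
    _ ≤ 3 * (β * K ^ 2 * frob (W - W')) :=
        mul_le_mul_of_nonneg_right (by norm_num) (by positivity)
    _ = _ := by ring
end

section
/- Let k ≥ 2, let ρ be a tail function, and let ℓ : ℝ^k × {1,…,k} → ℝ be a loss with template ℓ̃ : ℝ^{k−1} → ℝ (i.e. ℓ(ŷ, y) = ℓ̃(D_y ŷ)) satisfying ℓ̃(u) ≤ Σ_{j=1}^{k−1} ρ(u_j) for every u in the nonnegative orthant. Let S = ((x_1,y_1),…,(x_n,y_n)) ⊂ ℝ^d × {1,…,k} with ‖x_i‖₂ ≤ 1 for all i, and suppose there exists W* ∈ ℝ^{k×d} with ‖W*‖_F ≤ 1 such that (W*^{y_i} − W*^{j})·x_i ≥ γ > 0 for every i and every j ≠ y_i. Then for every 0 < ε < 1/2 there exists W*_ε ∈ ℝ^{k×d}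 (namely W*_ε = (ρ^{−1}(ε/k)/γ) W*) such that ‖W*_ε‖_F ≤ ρ^{−1}(ε/k)/γ and the empirical risk satisfies L̂(W*_ε) ≤ ε. -/
open Real Filter MeasureTheory Finset
open scoped ENNReal

/-- A tail function `ρ : [0,∞) → ℝ` (with values of `ρ` on negatives irrelevant), together with
its (one-sided) derivative `ρ'`: nonnegative, `1`-Lipschitz, convex, `β`-smooth, strictly
decreasing, tending to `0` at infinity, with `ρ(0) ≥ 1` and `|ρ'(0)| ≥ 1/2`. -/
structure IsTailFunction (β : ℝ) (ρ ρ' : ℝ → ℝ) : Prop where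
  nonneg : ∀ x, 0 ≤ x → 0 ≤ ρ x
  lipschitz : ∀ x, 0 ≤ x → ∀ y, 0 ≤ y → |ρ x - ρ y| ≤ |x - y|
  convexOn : ConvexOn ℝ (Set.Ici (0 : ℝ)) ρ
  hasDeriv : ∀ x, 0 ≤ x → HasDerivWithinAt ρ (ρ' x) (Set.Ici 0) x
  smooth : ∀ x, 0 ≤ x → ∀ y, 0 ≤ y → |ρ' x - ρ' y| ≤ β * |x - y|
  strictAnti : ∀ x, 0 ≤ x → ∀ y, x < y → ρ y < ρ x
  tendsto_zero : Filter.Tendsto ρ Filter.atTop (nhds 0)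
  one_le : 1 ≤ ρ 0
  deriv_zero : 1 / 2 ≤ |ρ' 0|

/-- The inverse of a tail function: for `0 < z ≤ ρ 0`, `tailInv ρ z` is the unique `u ≥ 0` with
`ρ u = z`. -/
noncomputable def tailInv (ρ : ℝ → ℝ) (z : ℝ) : ℝ := sInf {u : ℝ | 0 ≤ u ∧ ρ u ≤ z}

theorem tailInv_mem {β : ℝ} {ρ ρ' : ℝ → ℝ} (hρ : IsTailFunction β ρ ρ') {z : ℝ} (hz : 0 < z) :
    0 ≤ tailInv ρ z ∧ ρ (tailInv ρ z) ≤ z := by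
  have hc : ContinuousOn ρ (Set.Ici 0) := fun x hx => (hρ.hasDeriv x hx).continuousWithinAt
  have hcl : IsClosed {u : ℝ | 0 ≤ u ∧ ρ u ≤ z} :=
    hc.preimage_isClosed_of_isClosed isClosed_Ici isClosed_Iic
  have hne : {u : ℝ | 0 ≤ u ∧ ρ u ≤ z}.Nonempty := by
    obtain ⟨u, h1, h2⟩ := ((hρ.tendsto_zero.eventually (gt_mem_nhds hz)).and
      (eventually_ge_atTop 0)).exists
    exact ⟨u, h2, h1.le⟩
  exact hcl.csInf_mem hne ⟨0, fun u hu => hu.1⟩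

theorem skipIdx_ne {k : ℕ} (y : Fin k) (j : Fin (k - 1)) : skipIdx y j ≠ y := by
  intro h
  have h2 := congrArg Fin.val h
  unfold skipIdx at h2
  split_ifs at h2 <;> simp at h2 <;> omega

/-- under separability with margin `γ`, for any template bounded by
`Σ_j ρ(u_j)` on the nonnegative orthant (`ρ` a tail function) and any `0 < ε < 1/2`, the matrix
`W*_ε = (ρ⁻¹(ε/k)/γ) W*` has Frobenius norm at most `ρ⁻¹(ε/k)/γ` and empirical risk at most
`ε`. -/
theorem statement3 {k d n : ℕ} (hk : 2 ≤ k) (hn : 1 ≤ n)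
    (β : ℝ) (ρ ρ' : ℝ → ℝ) (hρ : IsTailFunction β ρ ρ')
    (ltil : (Fin (k - 1) → ℝ) → ℝ)
    (hbound : ∀ u : Fin (k - 1) → ℝ, (∀ j, 0 ≤ u j) → ltil u ≤ ∑ j, ρ (u j))
    (x : Fin n → Fin d → ℝ) (y : Fin n → Fin k)
    (hx : ∀ i, pnorm 2 (x i) ≤ 1)
    (γ : ℝ) (hγ : 0 < γ)
    (Wstar : Fin k → Fin d → ℝ) (hWnorm : frob Wstar ≤ 1)
    (hmargin : ∀ i, ∀ j, j ≠ y i → γ ≤ ∑ t, (Wstar (y i) t - Wstar j t) * x i t)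
    (ε : ℝ) (hε : 0 < ε) (hε' : ε < 1 / 2) :
    frob ((tailInv ρ (ε / k) / γ) • Wstar) ≤ tailInv ρ (ε / k) / γ ∧
    (1 / n : ℝ) * ∑ i, ltil (Dmap (y i)
        (fun r => ∑ t, ((tailInv ρ (ε / k) / γ) • Wstar) r t * x i t)) ≤ ε := by
  have hk0 : (0 : ℝ) < k := by
    have : 0 < k := by omega
    exact_mod_cast this
  have hn0 : (0 : ℝ) < n := by exact_mod_cast hn
  obtain ⟨hτ0, hτ⟩ := tailInv_mem hρ (div_pos hε hk0)
  set τ := tailInv ρ (ε / k) with hτdef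
  have hc : 0 ≤ τ / γ := div_nonneg hτ0 hγ.le
  constructor
  · have h : frob ((τ / γ) • Wstar) = τ / γ * frob Wstar := by
      unfold frob
      simp only [Pi.smul_apply, smul_eq_mul, mul_pow, ← Finset.mul_sum]
      rw [Real.sqrt_mul (sq_nonneg _), Real.sqrt_sq hc]
    rw [h]
    exact mul_le_of_le_one_right hc hWnorm
  · have key : ∀ i, ltil (Dmap (y i) (fun r => ∑ t, ((τ / γ) • Wstar) r t * x i t)) ≤ ε := by
      intro i
      have hge : ∀ j, τ ≤ Dmap (y i) (fun r => ∑ t, ((τ / γ) • Wstar) r t * x i t) j := by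
        intro j
        have hm := hmargin i _ (skipIdx_ne (y i) j)
        have he : Dmap (y i) (fun r => ∑ t, ((τ / γ) • Wstar) r t * x i t) j
            = τ / γ * ∑ t, (Wstar (y i) t - Wstar (skipIdx (y i) j) t) * x i t := by
          unfold Dmap
          rw [← Finset.sum_sub_distrib, Finset.mul_sum]
          refine Finset.sum_congr rfl fun t _ => ?_
          simp only [Pi.smul_apply, smul_eq_mul]
          ring
        rw [he]
        calc τ = τ / γ * γ := by field_simp
          _ ≤ _ := mul_le_mul_of_nonneg_left hm hc
      refine (hbound _ fun j => hτ0.trans (hge j)).trans ?_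
      have hle : ∀ j, ρ (Dmap (y i) (fun r => ∑ t, ((τ / γ) • Wstar) r t * x i t) j) ≤ ε / k := by
        intro j
        rcases (hge j).eq_or_lt with h | h
        · rw [← h]; exact hτ
        · exact (hρ.strictAnti _ hτ0 _ h).le.trans hτ
      refine (Finset.sum_le_sum fun j _ => hle j).trans ?_
      rw [Finset.sum_const, Finset.card_univ, Fintype.card_fin, nsmul_eq_mul]
      have hkk : ((k - 1 : ℕ) : ℝ) ≤ k := by exact_mod_cast Nat.sub_le k 1
      calc ((k - 1 : ℕ) : ℝ) * (ε / k) ≤ k * (ε / k) :=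
            mul_le_mul_of_nonneg_right hkk (div_pos hε hk0).le
        _ = ε := by field_simp
    have hs := Finset.sum_le_sum fun i (_ : i ∈ Finset.univ) => key i
    rw [Finset.sum_const, Finset.card_univ, Fintype.card_fin, nsmul_eq_mul] at hs
    calc _ ≤ (1 / n : ℝ) * (n * ε) := mul_le_mul_of_nonneg_left hs (by positivity)
      _ = ε := by field_simp
end

section
/- Let ρ be a tail function with smoothness parameter β, and define φ : ℝ → ℝ by φ(x) = ρ(x) for x ≥ 0 and φ(x) = ρ(0) + ρ′(0)x + (β/2)x² for x < 0. Then φ is nonnegative, convex, β-smooth (φ′ is β-Lipschitz on ℝ), and strictly decreasing. -/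
open Real Filter MeasureTheory Finset
open scoped ENNReal

/-- for a tail function `ρ` with smoothness parameter `β`, the extension
`φ(x) = ρ(x)` for `x ≥ 0` and `φ(x) = ρ(0) + ρ'(0)x + (β/2)x²` for `x < 0` is nonnegative,
convex, differentiable, `β`-smooth and strictly decreasing on `ℝ`. -/
theorem statement8 (β : ℝ) (ρ ρ' : ℝ → ℝ) (hρ : IsTailFunction β ρ ρ')
    (φ : ℝ → ℝ)
    (hφ : φ = fun x => if 0 ≤ x then ρ x else ρ 0 + ρ' 0 * x + β / 2 * x ^ 2) :
    (∀ x, 0 ≤ φ x) ∧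
    ConvexOn ℝ Set.univ φ ∧
    Differentiable ℝ φ ∧
    (∀ x y, |deriv φ x - deriv φ y| ≤ β * |x - y|) ∧
    StrictAnti φ := by
  have hβ : 0 ≤ β := by
    have h := hρ.smooth 0 le_rfl 1 zero_le_one
    have h2 := abs_nonneg (ρ' 0 - ρ' 1)
    norm_num at h
    linarith
  have h0 : ρ' 0 < 0 := by
    have h := hρ.convexOn.le_slope_of_hasDerivWithinAt (x := 0) (y := 1) (by simp) (by simp)
      one_pos (hρ.hasDeriv 0 le_rfl)
    have h2 := hρ.strictAnti 0 le_rfl 1 one_pos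
    rw [slope_def_field] at h
    norm_num at h
    linarith
  have hmono : ∀ x, 0 ≤ x → ∀ y, x ≤ y → ρ' x ≤ ρ' y := by
    intro x hx y hxy
    rcases hxy.eq_or_lt with rfl | hxy
    · exact le_rfl
    · exact (hρ.convexOn.le_slope_of_hasDerivWithinAt hx (hx.trans hxy.le) hxy
        (hρ.hasDeriv x hx)).trans (hρ.convexOn.slope_le_of_hasDerivWithinAt hx
          (hx.trans hxy.le) hxy (hρ.hasDeriv y (hx.trans hxy.le)))
  have hpos : ∀ x, 0 ≤ x → φ x = ρ x := by
    intro x hx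
    simp [hφ, hx]
  have hneg : ∀ x, x ≤ 0 → φ x = ρ 0 + ρ' 0 * x + β / 2 * x ^ 2 := by
    intro x hx
    rcases hx.eq_or_lt with rfl | hx
    · simp [hφ]
    · simp [hφ, not_le.mpr hx]
  have hq : ∀ x, HasDerivAt (fun x => ρ 0 + ρ' 0 * x + β / 2 * x ^ 2) (ρ' 0 + β * x) x := by
    intro x
    have h1 := ((hasDerivAt_id x).const_mul (ρ' 0)).const_add (ρ 0)
    have h2 := ((hasDerivAt_id x).pow 2).const_mul (β / 2)
    refine (h1.add h2).congr_deriv ?_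
    simp
    ring
  have hR : ∀ x, 0 ≤ x → HasDerivWithinAt φ (ρ' x) (Set.Ici 0) x := fun x hx =>
    (hρ.hasDeriv x hx).congr (fun y hy => hpos y hy) (hpos x hx)
  have hL : ∀ x, x ≤ 0 → HasDerivWithinAt φ (ρ' 0 + β * x) (Set.Iic 0) x := fun x hx =>
    (hq x).hasDerivWithinAt.congr (fun y hy => hneg y hy) (hneg x hx)
  have hdp : ∀ x, 0 ≤ x → HasDerivAt φ (ρ' x) x := by
    intro x hx
    rcases hx.eq_or_lt with rfl | hx'
    · have h := (hL 0 le_rfl).union ((hR 0 le_rfl).congr_deriv (by simp))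
      rw [Set.Iic_union_Ici, hasDerivWithinAt_univ] at h
      simpa using h
    · exact (hR x hx).hasDerivAt (Ici_mem_nhds hx')
  have hdn : ∀ x, x < 0 → HasDerivAt φ (ρ' 0 + β * x) x := fun x hx =>
    (hL x hx.le).hasDerivAt (Iic_mem_nhds hx)
  have hdiff : Differentiable ℝ φ := by
    intro x
    rcases le_or_gt 0 x with hx | hx
    · exact (hdp x hx).differentiableAt
    · exact (hdn x hx).differentiableAt
  have key : ∀ x y, x ≤ y → deriv φ x ≤ deriv φ y ∧ deriv φ y - deriv φ x ≤ β * (y - x) := by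
    intro x y hxy
    rcases le_or_gt 0 x with hx | hx
    · have hy := hx.trans hxy
      rw [(hdp x hx).deriv, (hdp y hy).deriv]
      refine ⟨hmono x hx y hxy, ?_⟩
      have h := hρ.smooth y hy x hx
      rw [abs_of_nonneg (sub_nonneg.mpr hxy)] at h
      exact (le_abs_self _).trans h
    · rcases le_or_gt 0 y with hy | hy
      · rw [(hdn x hx).deriv, (hdp y hy).deriv]
        have h1 := hmono 0 le_rfl y hy
        have h := (le_abs_self _).trans (hρ.smooth y hy 0 le_rfl)
        rw [sub_zero, abs_of_nonneg hy] at h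
        constructor <;> nlinarith
      · rw [(hdn x hx).deriv, (hdn y hy).deriv]
        constructor <;> nlinarith
  have hanti : StrictAnti φ := by
    have hnn : ∀ x y, x < y → y ≤ 0 → φ y < φ x := by
      intro x y hxy hy
      rw [hneg x (hxy.le.trans hy), hneg y hy]
      have h1 : 0 ≤ β * ((y - x) * (-y - x)) :=
        mul_nonneg hβ (mul_nonneg (by linarith) (by linarith))
      nlinarith
    have hpp : ∀ x y, x < y → 0 ≤ x → φ y < φ x := by
      intro x y hxy hx
      rw [hpos x hx, hpos y (hx.trans hxy.le)]
      exact hρ.strictAnti x hx y hxy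
    intro x y hxy
    rcases le_or_gt 0 x with hx | hx
    · exact hpp x y hxy hx
    · rcases le_or_gt y 0 with hy | hy
      · exact hnn x y hxy hy
      · exact (hpp 0 y hy le_rfl).trans (hnn x 0 hx le_rfl)
  refine ⟨?_, Monotone.convexOn_univ_of_deriv hdiff fun x y h => (key x y h).1, hdiff, ?_, hanti⟩
  · intro x
    rcases le_or_gt 0 x with hx | hx
    · rw [hpos x hx]
      exact hρ.nonneg x hx
    · have h := hanti hx
      rw [hpos 0 le_rfl] at h
      linarith [hρ.one_le]
  · intro x y
    rcases le_total x y with h | h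
    · obtain ⟨h1, h2⟩ := key x y h
      rw [abs_sub_comm, abs_sub_comm x y, abs_of_nonneg (by linarith), abs_of_nonneg (by linarith)]
      exact h2
    · obtain ⟨h1, h2⟩ := key y x h
      rw [abs_of_nonneg (by linarith), abs_of_nonneg (by linarith)]
      exact h2
end

section
/- Let k ≥ 2, let φ : ℝ → ℝ be differentiable, let x_1, …, x_n ∈ ℝ^d, and consider the empirical objective L̂(W) = (1/n) Σ_{i=1}^n Σ_{j=2}^{k} φ(⟨W^1 − W^j, x_i⟩) on ℝ^{k×d}, where W^j denotes the j-th row of W (this is the empirical risk of the loss ℓ_{x,y}(W) = Σ_{j≠y} φ(⟨W^y − W^j, x⟩) on a sample whose labels all equal 1). Let W_1 = 0 and W_{t+1} = W_t − η ∇L̂(W_t) for some step size η > 0. Then for every t ≥ 1 and every pair of indices j, j′ ∈ {2,…,k}, the rows W_t^j and W_t^{j′} are equal. -/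
open Real Filter MeasureTheory Finset
open scoped ENNReal

/-- for the objective `L̂(W) = (1/n) Σ_i Σ_{j ≠ 1} φ(⟨W^1 - W^j, x_i⟩)`
(rows indexed by `Fin k`, with row `0` playing the role of the first row), all non-first rows of
every gradient descent iterate coincide. -/
theorem statement10 {k d n : ℕ} [NeZero k] (hk : 2 ≤ k) (hn : 1 ≤ n)
    (φ : ℝ → ℝ) (hφdiff : Differentiable ℝ φ)
    (x : Fin n → Fin d → ℝ)
    (Lhat : (Fin k → Fin d → ℝ) → ℝ)
    (hLhat : Lhat = fun W => (1 / n : ℝ) * ∑ i, ∑ j ∈ Finset.univ \ {(0 : Fin k)},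
      φ (∑ t, (W 0 t - W j t) * x i t))
    (η : ℝ) (hη : 0 < η)
    (W : ℕ → Fin k → Fin d → ℝ) (hW1 : W 1 = 0)
    (hWrec : ∀ t, 1 ≤ t → W (t + 1) = W t - η • gradM Lhat (W t)) :
    ∀ t, 1 ≤ t → ∀ j j' : Fin k, j ≠ 0 → j' ≠ 0 → W t j = W t j' := by
  intro t ht
  induction t, ht using Nat.le_induction with
  | base => intro j j' _ _; rw [hW1]; rfl
  | succ t ht ih =>
    intro j j' hj hj'
    have hfix : ∀ a, W t (Equiv.swap j j' a) = W t a := by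
      intro a
      by_cases h1 : a = j
      · subst h1; rw [Equiv.swap_apply_left]; exact ih _ _ hj' hj
      by_cases h2 : a = j'
      · subst h2; rw [Equiv.swap_apply_right]; exact ih _ _ hj hj'
      rw [Equiv.swap_apply_of_ne_of_ne h1 h2]
    let P : (Fin k → Fin d → ℝ) ≃L[ℝ] (Fin k → Fin d → ℝ) :=
      (LinearEquiv.funCongrLeft ℝ (Fin d → ℝ) (Equiv.swap j j')).toContinuousLinearEquiv
    have hP : ∀ V a, P V a = V (Equiv.swap j j' a) := fun V a => rfl
    have hPW : P (W t) = W t := funext fun a => by rw [hP, hfix]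
    have hL : Lhat ∘ P = Lhat := by
      funext V
      subst hLhat
      simp only [Function.comp, hP, Equiv.swap_apply_of_ne_of_ne hj.symm hj'.symm]
      congr 1
      refine Finset.sum_congr rfl fun i _ => ?_
      refine Finset.sum_equiv (Equiv.swap j j') ?_ (fun _ _ => rfl)
      intro a
      have : Equiv.swap j j' a = 0 ↔ a = 0 := by
        rw [Equiv.swap_apply_eq_iff, Equiv.swap_apply_of_ne_of_ne hj.symm hj'.symm]
      simp [this]
    have hg : ∀ v, fderiv ℝ Lhat (W t) (P v) = fderiv ℝ Lhat (W t) v := by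
      intro v
      have h := P.comp_right_fderiv (f := Lhat) (x := W t)
      rw [hL, hPW] at h
      conv_rhs => rw [h]
      rfl
    rw [hWrec t ht]
    funext s
    have hs : P (Pi.single j' (Pi.single s 1)) = Pi.single j (Pi.single s 1) := by
      funext a
      rw [hP, Pi.single_apply, Pi.single_apply]
      have : Equiv.swap j j' a = j' ↔ a = j := by
        rw [Equiv.swap_apply_eq_iff, Equiv.swap_apply_right]
      simp [this]
    simp only [Pi.sub_apply, Pi.smul_apply, gradM]
    rw [← hs, hg, ih j j' hj hj']
end

section
/- Let n ≥ 35, let 0 < γ ≤ 1/8, and let D be the distribution on ℝ³ × {1,…,k} that puts mass (59/64)(1 − 1/n) on ((1,0,0), 1), mass (5/64)(1 − 1/n) on ((−1/2, 3γ, 0), 1), and mass 1/n on ((0, −1/8, 4γ + 1/4), 1). Let S = ((x_1,y_1),…,(x_n,y_n)) be an i.i.d. sample from D and let (x′, y′) ~ D be independent of S. Let δ₂ be the fraction of indices i with x_i = (−1/2, 3γ, 0). Then the probability of the event A = {x_i ≠ (0,−1/8,4γ+1/4) for all i} ∩ {x′ = (0,−1/8,4γ+1/4)} ∩ {δ₂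 ∈ [1/32, 1/8]} satisfies Pr(A) ≥ 1/(120 e n). -/
open Real Filter MeasureTheory Finset
open scoped ENNReal

open scoped Classical



theorem cheb_aux {E : Type*} [MeasurableSpace E] (P : Measure E) [IsProbabilityMeasure P]
    (T : Set E) (hT : MeasurableSet T) (hPT : P.real T = 5 / 64) (n : ℕ) (hn : 0 < n) :
    ENNReal.ofReal (1 - 295 / (9 * n)) ≤ (Measure.pi fun _ : Fin n => P)
      {ω | 1 / 32 ≤ (((Finset.univ.filter fun i => ω i ∈ T).card : ℝ) / n) ∧
          (((Finset.univ.filter fun i => ω i ∈ T).card : ℝ) / n) ≤ 1 / 8} := by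
  set f : E → ℝ := T.indicator (fun _ => 1) with hf
  have hn' : (0 : ℝ) < n := by exact_mod_cast hn
  have hfm : MemLp f 2 P := memLp_indicator_const 2 hT 1 (Or.inr (measure_ne_top _ _))
  have hEf : ∫ x, f x ∂P = 5 / 64 := by
    rw [hf, integral_indicator_const _ hT, hPT]; simp
  have hf2 : f ^ 2 = f := by
    ext x
    by_cases h : x ∈ T <;> simp [hf, h]
  have hVf : ProbabilityTheory.variance f P = 295 / 4096 := by
    rw [ProbabilityTheory.variance_eq_sub hfm, hf2, hEf]; norm_num
  set X : (Fin n → E) → ℝ := ∑ i, fun ω => f (ω i) with hX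
  set μ := Measure.pi fun _ : Fin n => P with hμ
  have hXi : ∀ i : Fin n, MemLp (fun ω : Fin n → E => f (ω i)) 2 μ := fun i =>
    hfm.comp_measurePreserving (measurePreserving_eval _ i)
  have hXm : MemLp X 2 μ := memLp_finsetSum' _ fun i _ => hXi i
  have hVX : ProbabilityTheory.variance X μ = n * (295 / 4096) := by
    rw [hX, hμ, ProbabilityTheory.variance_sum_pi (fun _ => hfm)]
    simp [hVf]
  have hEX : ∫ ω, X ω ∂μ = n * (5 / 64) := by
    simp only [hX, Finset.sum_apply]
    rw [integral_finsetSum _ fun i _ => (hXi i).integrable (by norm_num)]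
    have : ∀ i : Fin n, ∫ ω : Fin n → E, f (ω i) ∂μ = 5 / 64 := fun i => by
      rw [hμ, integral_comp_eval (μ := fun _ : Fin n => P) (i := i) hfm.aestronglyMeasurable, hEf]
    simp [this]
  have hc := ProbabilityTheory.meas_ge_le_variance_div_sq hXm
    (c := n * (3 / 64)) (by positivity)
  rw [hVX, hEX] at hc
  have hXc : ∀ ω, X ω = ((Finset.univ.filter fun i => ω i ∈ T).card : ℝ) := by
    intro ω
    simp [hX, hf, Set.indicator_apply, Finset.sum_apply]
  set C := {ω : Fin n → E | 1 / 32 ≤ (((Finset.univ.filter fun i => ω i ∈ T).card : ℝ) / n) ∧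
          (((Finset.univ.filter fun i => ω i ∈ T).card : ℝ) / n) ≤ 1 / 8} with hC
  have hsub : Cᶜ ⊆ {ω | n * (3 / 64) ≤ |X ω - n * (5 / 64)|} := by
    intro ω hω
    by_contra hcon
    apply hω
    simp only [Set.mem_ofPred_eq, not_le, abs_lt] at hcon
    rw [hC, Set.mem_ofPred_eq, ← hXc, le_div_iff₀ hn', div_le_iff₀ hn']
    constructor <;> linarith [hcon.1, hcon.2]
  have h1 : (1 : ℝ≥0∞) ≤ μ C + μ Cᶜ := by
    rw [← measure_univ (μ := μ), ← Set.union_compl_self C]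
    exact measure_union_le _ _
  have h2 : μ Cᶜ ≤ ENNReal.ofReal (295 / (9 * n)) := by
    refine (measure_mono hsub).trans (hc.trans (le_of_eq ?_))
    congr 1
    field_simp
    norm_num
  rw [ENNReal.ofReal_sub _ (by positivity), ENNReal.ofReal_one]
  refine tsub_le_iff_right.2 (h1.trans ?_)
  gcongr

theorem pi_smul_aux {E : Type*} [MeasurableSpace E] (P : Measure E) [IsProbabilityMeasure P]
    (c : ℝ≥0∞) (hc : c ≠ ∞) (n : ℕ) :
    (Measure.pi fun _ : Fin n => c • P) = c ^ n • Measure.pi fun _ : Fin n => P := by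
  have : IsFiniteMeasure (c • P) := ⟨by simp [hc.lt_top]⟩
  refine Measure.pi_eq fun s _ => ?_
  simp [Measure.pi_pi, Finset.prod_mul_distrib]

theorem num_aux (n : ℕ) (hn : 35 ≤ n) :
    1 / (120 * Real.exp 1 * n) ≤ (1 - 1 / (n : ℝ)) ^ n * (1 - 295 / (9 * n)) * (1 / n) := by
  have hn' : (35 : ℝ) ≤ n := by exact_mod_cast hn
  have h0 : (0 : ℝ) < n := by linarith
  have hq : 1 / (3 * Real.exp 1) ≤ (1 - 1 / (n : ℝ)) ^ n := by
    have h1 : Real.exp (-(2 / n)) ≤ 1 - 1 / (n : ℝ) := by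
      rw [Real.exp_neg]
      have ha : 1 + 2 / (n : ℝ) ≤ Real.exp (2 / n) := by
        linarith [Real.add_one_le_exp (2 / (n : ℝ))]
      refine (inv_anti₀ (by positivity) ha).trans ?_
      rw [inv_le_iff_one_le_mul₀ (by positivity)]
      have : (1 - 1 / (n : ℝ)) * (1 + 2 / n) = 1 + (n - 2) / n ^ 2 := by
        field_simp; ring
      rw [this]
      have : 0 ≤ ((n : ℝ) - 2) / n ^ 2 := div_nonneg (by linarith) (by positivity)
      linarith
    have h2 : Real.exp (-2) ≤ (1 - 1 / (n : ℝ)) ^ n := by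
      calc Real.exp (-2) = Real.exp (-(2 / n)) ^ n := by
            rw [← Real.exp_nat_mul]; congr 1; field_simp
        _ ≤ _ := pow_le_pow_left₀ (Real.exp_pos _).le h1 n
    refine le_trans ?_ h2
    rw [show (-2 : ℝ) = -(1 + 1) by norm_num, Real.exp_neg, Real.exp_add, ← one_div]
    apply one_div_le_one_div_of_le (by positivity)
    have := Real.exp_one_lt_d9
    gcongr
    linarith
  have hr : 1 / 40 ≤ 1 - 295 / (9 * (n : ℝ)) := by
    have : 295 / (9 * (n : ℝ)) ≤ 295 / (9 * 35) := by gcongr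
    norm_num at this ⊢
    linarith
  calc 1 / (120 * Real.exp 1 * n) = 1 / (3 * Real.exp 1) * (1 / 40) * (1 / n) := by
        field_simp; norm_num
    _ ≤ _ := by
        have : 0 ≤ (1 - 1 / (n : ℝ)) ^ n := le_trans (by positivity) hq
        gcongr

/-- for the three-point distribution of the lower-bound construction, with
probability at least `1/(120 e n)` the validation point is the rare point `x₃`, no sample point
equals `x₃`, and the empirical fraction of `x₂` lies in `[1/32, 1/8]`. -/
theorem statement13 {k n : ℕ} [NeZero k] (hk : 2 ≤ k) (hn : 35 ≤ n)
    (γ : ℝ) (hγ0 : 0 < γ) (hγ : γ ≤ 1 / 8)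
    (D : Measure ((Fin 3 → ℝ) × Fin k)) [IsProbabilityMeasure D]
    (hD : D = ENNReal.ofReal ((59 / 64) * (1 - 1 / n)) • Measure.dirac (![1, 0, 0], 0)
        + ENNReal.ofReal ((5 / 64) * (1 - 1 / n)) • Measure.dirac (![-(1 / 2), 3 * γ, 0], 0)
        + ENNReal.ofReal (1 / n) • Measure.dirac (![0, -(1 / 8), 4 * γ + 1 / 4], 0)) :
    ENNReal.ofReal (1 / (120 * Real.exp 1 * n)) ≤
      ((Measure.pi fun _ : Fin n => D).prod D)
        {ω : (Fin n → (Fin 3 → ℝ) × Fin k) × ((Fin 3 → ℝ) × Fin k) |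
          (∀ i, (ω.1 i).1 ≠ ![0, -(1 / 8), 4 * γ + 1 / 4]) ∧
          ω.2.1 = ![0, -(1 / 8), 4 * γ + 1 / 4] ∧
          1 / 32 ≤ (((Finset.univ.filter fun i => (ω.1 i).1 = ![-(1 / 2), 3 * γ, 0]).card : ℝ) / n) ∧
          (((Finset.univ.filter fun i => (ω.1 i).1 = ![-(1 / 2), 3 * γ, 0]).card : ℝ) / n) ≤ 1 / 8} := by
  have hn' : (35 : ℝ) ≤ n := by exact_mod_cast hn
  have h0 : (0 : ℝ) < n := by linarith
  have hq0 : (0 : ℝ) ≤ 1 - 1 / n := by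
    rw [sub_nonneg, div_le_one h0]; linarith
  set a1 : Fin 3 → ℝ := ![1, 0, 0] with ha1
  set a2 : Fin 3 → ℝ := ![-(1 / 2), 3 * γ, 0] with ha2
  set a3 : Fin 3 → ℝ := ![0, -(1 / 8), 4 * γ + 1 / 4] with ha3
  have h12 : a1 ≠ a2 := fun h => by
    have := congrFun h 0; norm_num [ha1, ha2] at this
  have h13 : a1 ≠ a3 := fun h => by
    have := congrFun h 0; norm_num [ha1, ha3] at this
  have h23 : a2 ≠ a3 := fun h => by
    have := congrFun h 0; norm_num [ha2, ha3] at this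
  clear_value a1 a2 a3
  set P : Measure ((Fin 3 → ℝ) × Fin k) := ENNReal.ofReal (59 / 64) • Measure.dirac (a1, 0)
    + ENNReal.ofReal (5 / 64) • Measure.dirac (a2, 0) with hP
  have hPprob : IsProbabilityMeasure P := ⟨by
    simp only [hP, Measure.add_apply, Measure.smul_apply, measure_univ, smul_eq_mul, mul_one]
    rw [← ENNReal.ofReal_add (by norm_num) (by norm_num)]; norm_num⟩
  set T : Set ((Fin 3 → ℝ) × Fin k) := {x | x.1 = a2} with hTdef
  have hT : MeasurableSet T := measurable_fst (measurableSet_singleton a2)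
  set U : Set ((Fin 3 → ℝ) × Fin k) := {x | x.1 = a3} with hUdef
  have hU : MeasurableSet U := measurable_fst (measurableSet_singleton a3)
  have hPT : P.real T = 5 / 64 := by
    simp [Measure.real, hP, hTdef, h12]
    norm_num
  have hDU : D U = ENNReal.ofReal (1 / n) := by
    rw [hD]
    simp [hUdef, h13, h23]
  have hDr : D.restrict Uᶜ = ENNReal.ofReal (1 - 1 / n) • P := by
    rw [hD, hP, Measure.restrict_add, Measure.restrict_add, Measure.restrict_smul,
      Measure.restrict_smul, Measure.restrict_smul, MeasureTheory.restrict_dirac,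
      MeasureTheory.restrict_dirac, MeasureTheory.restrict_dirac, smul_add, smul_smul, smul_smul,
      ← ENNReal.ofReal_mul hq0, ← ENNReal.ofReal_mul hq0]
    simp [hUdef, h13, h23, mul_comm]
  set C := {ω : Fin n → (Fin 3 → ℝ) × Fin k |
      1 / 32 ≤ (((Finset.univ.filter fun i => ω i ∈ T).card : ℝ) / n) ∧
      (((Finset.univ.filter fun i => ω i ∈ T).card : ℝ) / n) ≤ 1 / 8} with hC
  have hcheb : ENNReal.ofReal (1 - 295 / (9 * n)) ≤ (Measure.pi fun _ : Fin n => P) C := by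
    convert! cheb_aux P T hT hPT n (by omega) using 2
    rw [hC]
    ext ω
    simp only [Set.mem_ofPred_eq]
    congr!
  have hset : {ω : (Fin n → (Fin 3 → ℝ) × Fin k) × ((Fin 3 → ℝ) × Fin k) |
          (∀ i, (ω.1 i).1 ≠ a3) ∧ ω.2.1 = a3 ∧
          1 / 32 ≤ (((Finset.univ.filter fun i => (ω.1 i).1 = a2).card : ℝ) / n) ∧
          (((Finset.univ.filter fun i => (ω.1 i).1 = a2).card : ℝ) / n) ≤ 1 / 8}
      = (C ∩ Set.univ.pi fun _ => Uᶜ) ×ˢ U := by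
    ext ω
    simp only [hC, hTdef, hUdef, Set.mem_ofPred_eq, Set.mem_prod, Set.mem_inter_iff,
      Set.mem_pi, Set.mem_univ, true_imp_iff, Set.mem_compl_iff, ne_eq]
    tauto
  rw [hset, Measure.prod_prod, hDU,
    ← Measure.restrict_apply' (MeasurableSet.univ_pi fun _ => hU.compl),
    Measure.restrict_pi_pi, hDr, pi_smul_aux P _ ENNReal.ofReal_ne_top, Measure.smul_apply,
    smul_eq_mul]
  refine (ENNReal.ofReal_le_ofReal (num_aux n hn)).trans ?_
  rw [ENNReal.ofReal_mul' (by positivity), ENNReal.ofReal_mul (by positivity),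
    ENNReal.ofReal_pow hq0]
  gcongr
end

section
/- Let k ≥ 2, let ρ be a tail function with smoothness parameter β, let 0 < γ ≤ 1/8, let T ≥ 1, n ≥ 1, 0 < η ≤ 1/(6βk), and let ε > 0 satisfy ρ^{−1}(ε/k)² / (γ² η T) ≤ ε ≤ 1/16. Set p₀ = ρ^{−1}(16ε/k) / (72 γ² T k η) (which then satisfies p₀ ≤ ε ≤ 1/16). Let D be the distribution on ℝ² × {1,…,k} putting mass 1 − p₀ on ((1,0), 1) and mass p₀ on ((−1/2, 3γ), 1). Define φ(x) = ρ(x) for x ≥ 0 and φ(x) = ρ(0) + ρ′(0)x for x < 0, and the loss ℓ(ŷ, y) = Σ_{j≠y} φ(ŷ_y − ŷ_j). For an i.i.d. sample S of size n from D, let W_T be the T-th iterate of gradient descent on the empirical risk L̂_S with step size η started from W_1 = 0. Then E_S[L(W_T)] ≥ ρ^{−1}(16ε/k)² / (5000 γ² η T), where L(W) = E_{(x,y)~D}[ℓ(Wx, y)]. -/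
open Real Filter MeasureTheory Finset
open scoped ENNReal

/-- Gradient descent iterates on objective `F` with step size `η`, started from `0`:
`gdFrom η F s` is the iterate after `s` gradient steps (so `W_T = gdFrom η F (T - 1)` when
iterates are numbered `W_1 = 0, W_2, …`). -/
noncomputable def gdFrom {k d : ℕ} (η : ℝ) (F : (Fin k → Fin d → ℝ) → ℝ) :
    ℕ → (Fin k → Fin d → ℝ)
  | 0 => 0
  | t + 1 => gdFrom η F t - η • gradM F (gdFrom η F t)

/-- The multiclass loss `ℓ(v, y) = Σ_{j ≠ y} φ(v_y - v_j)` built from a univariate function. -/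
noncomputable def mcLoss {k : ℕ} (φ : ℝ → ℝ) (v : Fin k → ℝ) (y : Fin k) : ℝ :=
  ∑ j ∈ Finset.univ \ {y}, φ (v y - v j)

/-- The empirical risk of `W` on the sample `S` for the loss `mcLoss φ`. -/
noncomputable def empRisk {k d n : ℕ} (φ : ℝ → ℝ) (S : Fin n → (Fin d → ℝ) × Fin k)
    (W : Fin k → Fin d → ℝ) : ℝ :=
  (1 / n : ℝ) * ∑ i, mcLoss φ (fun r => ∑ t, W r t * (S i).1 t) (S i).2

lemma tail_deriv_nonpos {β : ℝ} {ρ ρ' : ℝ → ℝ} (hρ : IsTailFunction β ρ ρ') (x : ℝ) (hx : 0 ≤ x) :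
    ρ' x ≤ 0 ∧ -1 ≤ ρ' x := by
  have h1 : HasDerivWithinAt ρ (ρ' x) (Set.Ioi x) x :=
    (hρ.hasDeriv x hx).mono (fun y hy => hx.trans (le_of_lt hy))
  rw [hasDerivWithinAt_iff_tendsto_slope' (by simp)] at h1
  constructor
  · refine le_of_tendsto h1 ?_
    filter_upwards [self_mem_nhdsWithin] with y hy
    have hy' : x < y := hy
    rw [slope_def_field]
    exact div_nonpos_of_nonpos_of_nonneg (by linarith [hρ.strictAnti x hx y hy']) (by linarith)
  · refine ge_of_tendsto h1 ?_
    filter_upwards [self_mem_nhdsWithin] with y hy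
    have hy' : x < y := hy
    rw [slope_def_field, le_div_iff₀ (by linarith)]
    have h2 := hρ.lipschitz x hx y (by linarith)
    have h3 := le_abs_self (ρ x - ρ y)
    rw [abs_of_neg (by linarith : x - y < 0)] at h2
    linarith

lemma tail_tangent {β : ℝ} {ρ ρ' : ℝ → ℝ} (hρ : IsTailFunction β ρ ρ') (x : ℝ) (hx : 0 ≤ x) :
    ρ 0 + ρ' 0 * x ≤ ρ x := by
  rcases hx.eq_or_lt with rfl | hx
  · simp
  have h1 : HasDerivWithinAt ρ (ρ' 0) (Set.Ioi 0) 0 :=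
    (hρ.hasDeriv 0 le_rfl).mono (fun y hy => Set.mem_Ici.2 (le_of_lt hy))
  have := hρ.convexOn.le_slope_of_hasDerivWithinAt_Ioi (by simp) (Set.mem_Ici.2 hx.le) hx h1
  rw [slope_def_field, le_div_iff₀ (by linarith)] at this
  linarith

lemma phi_hasDeriv {β : ℝ} {ρ ρ' : ℝ → ℝ} (hρ : IsTailFunction β ρ ρ') (x : ℝ) :
    HasDerivAt (fun x => if 0 ≤ x then ρ x else ρ 0 + ρ' 0 * x)
      (if 0 ≤ x then ρ' x else ρ' 0) x := by
  have hlin : ∀ x, HasDerivAt (fun x => ρ 0 + ρ' 0 * x) (ρ' 0) x := fun x => by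
    simpa using ((hasDerivAt_id x).const_mul (ρ' 0)).const_add (ρ 0)
  rcases lt_trichotomy x 0 with h | rfl | h
  · rw [if_neg (not_le.2 h)]
    refine (hlin x).congr_of_eventuallyEq ?_
    filter_upwards [Iio_mem_nhds h] with y hy
    rw [if_neg (not_le.2 hy)]
  · rw [if_pos le_rfl]
    rw [← hasDerivWithinAt_univ, ← Set.Iic_union_Ici (a := (0:ℝ))]
    refine HasDerivWithinAt.union ?_ ?_
    · refine (hlin 0).hasDerivWithinAt.congr ?_ (by simp)
      intro y hy
      rcases (show y ≤ 0 from hy).eq_or_lt with rfl | hy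
      · simp
      · simp [not_le.2 hy]
    · refine (hρ.hasDeriv 0 le_rfl).congr ?_ (by simp)
      intro y hy
      exact if_pos hy
  · rw [if_pos h.le]
    refine ((hρ.hasDeriv x h.le).hasDerivAt (Ici_mem_nhds h)).congr_of_eventuallyEq ?_
    filter_upwards [Ioi_mem_nhds h] with y hy
    rw [if_pos (le_of_lt hy)]

lemma gradM_empRisk {k d n : ℕ} [NeZero k] (φ dφ : ℝ → ℝ) (hd : ∀ x, HasDerivAt φ (dφ x) x)
    (S : Fin n → (Fin d → ℝ) × Fin k) (hS : ∀ i, (S i).2 = 0) (W : Fin k → Fin d → ℝ)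
    (r : Fin k) (t : Fin d) :
    gradM (empRisk φ S) W r t = (1 / n : ℝ) * ∑ i, ∑ j ∈ Finset.univ \ {(0 : Fin k)},
      dφ (∑ t, W 0 t * (S i).1 t - ∑ t, W j t * (S i).1 t) *
        ((if r = 0 then (S i).1 t else 0) - (if r = j then (S i).1 t else 0)) := by
  let P : Fin n → Fin k → ((Fin k → Fin d → ℝ) →L[ℝ] ℝ) := fun i r =>
    ∑ t, ((S i).1 t) • ((ContinuousLinearMap.proj t : (Fin d → ℝ) →L[ℝ] ℝ).comp
      (ContinuousLinearMap.proj r : (Fin k → Fin d → ℝ) →L[ℝ] (Fin d → ℝ)))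
  have hP : ∀ i r W, P i r W = ∑ t, W r t * (S i).1 t := by
    intro i r W
    simp [P, mul_comm]
  have hP1 : ∀ i r', P i r' (Pi.single r (Pi.single t 1)) = if r = r' then (S i).1 t else 0 := by
    intro i r'
    rw [hP]
    by_cases h : r = r'
    · subst h
      simp [Pi.single_apply]
    · rw [if_neg h]
      simp [Pi.single_apply, Ne.symm h]
  have hE : empRisk φ S = fun W => (1 / n : ℝ) * ∑ i, ∑ j ∈ Finset.univ \ {(0 : Fin k)},
      φ ((P i 0 - P i j) W) := by
    funext W
    simp [empRisk, mcLoss, hS, hP]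
  have hF : HasFDerivAt (empRisk φ S) ((1 / n : ℝ) • ∑ i, ∑ j ∈ Finset.univ \ {(0 : Fin k)},
      dφ ((P i 0 - P i j) W) • (P i 0 - P i j)) W := by
    rw [hE]
    refine HasFDerivAt.const_mul ?_ _
    refine HasFDerivAt.fun_sum fun i _ => HasFDerivAt.fun_sum fun j _ => ?_
    exact (hd _).comp_hasFDerivAt W (P i 0 - P i j).hasFDerivAt
  unfold gradM
  rw [hF.fderiv]
  have hm : ∀ i j, dφ (∑ t, W 0 t * (S i).1 t - ∑ t, W j t * (S i).1 t) *
      ((if r = 0 then (S i).1 t else 0) - (if r = j then (S i).1 t else 0)) =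
      (dφ ((P i 0 - P i j) W) • (P i 0 - P i j)) (Pi.single r (Pi.single t 1)) := by
    intro i j
    rw [ContinuousLinearMap.smul_apply, ContinuousLinearMap.sub_apply,
      ContinuousLinearMap.sub_apply, hP1, hP1, hP, hP, smul_eq_mul]
  simp only [hm, ContinuousLinearMap.smul_apply, ContinuousLinearMap.sum_apply, smul_eq_mul]

lemma gd_bound {k n : ℕ} [NeZero k] (φ dφ : ℝ → ℝ) (hd : ∀ x, HasDerivAt φ (dφ x) x)
    (h0 : ∀ x, dφ x ≤ 0) (h1 : ∀ x, -1 ≤ dφ x) (η : ℝ) (hη : 0 < η)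
    (S : Fin n → (Fin 2 → ℝ) × Fin k) (hS : ∀ i, (S i).2 = 0) (hS1 : ∀ i, 0 ≤ (S i).1 1)
    (j : Fin k) (hj : j ≠ 0) (s : ℕ) :
    gdFrom η (empRisk φ S) s 0 1 - gdFrom η (empRisk φ S) s j 1
      ≤ s * (η * k * ((1 / n : ℝ) * ∑ i, (S i).1 1)) := by
  induction s with
  | zero => simp [gdFrom]
  | succ s ih =>
    set W := gdFrom η (empRisk φ S) s with hW
    have e : ∀ r, gdFrom η (empRisk φ S) (s+1) r 1 = W r 1 - η * gradM (empRisk φ S) W r 1 := by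
      intro r; simp [gdFrom, hW]
    have hcard : ((Finset.univ \ {(0 : Fin k)}).card : ℝ) = k - 1 := by
      rw [Finset.card_sdiff_of_subset (by simp)]
      simp [Nat.cast_sub (NeZero.one_le : 1 ≤ k)]
    have g0 : -((k - 1) * ((1 / n : ℝ) * ∑ i, (S i).1 1)) ≤ gradM (empRisk φ S) W 0 1 := by
      rw [gradM_empRisk φ dφ hd S hS]
      have : -((k - 1) * ((1 / n : ℝ) * ∑ i, (S i).1 1))
          = (1 / n : ℝ) * ∑ i, ∑ j ∈ Finset.univ \ {(0 : Fin k)}, (- (S i).1 1) := by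
        simp only [Finset.sum_const, nsmul_eq_mul, hcard]
        rw [← Finset.mul_sum, Finset.sum_neg_distrib]; ring
      rw [this]
      refine mul_le_mul_of_nonneg_left ?_ (by positivity)
      refine Finset.sum_le_sum fun i _ => Finset.sum_le_sum fun j' hj' => ?_
      have : j' ≠ 0 := by simpa using hj'
      rw [if_pos rfl, if_neg this.symm]
      nlinarith [h1 (∑ t, W 0 t * (S i).1 t - ∑ t, W j' t * (S i).1 t), hS1 i]
    have gj : gradM (empRisk φ S) W j 1 ≤ (1 / n : ℝ) * ∑ i, (S i).1 1 := by
      rw [gradM_empRisk φ dφ hd S hS]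
      refine mul_le_mul_of_nonneg_left ?_ (by positivity)
      refine Finset.sum_le_sum fun i _ => ?_
      rw [Finset.sum_eq_single j]
      · rw [if_neg hj, if_pos rfl]
        nlinarith [h1 (∑ t, W 0 t * (S i).1 t - ∑ t, W j t * (S i).1 t), hS1 i]
      · intro b _ hb
        rw [if_neg hj, if_neg hb.symm]; ring
      · intro h; simp [hj] at h
    rw [e, e]
    push_cast
    nlinarith

lemma tailInv_facts {β : ℝ} {ρ ρ' : ℝ → ℝ} (hρ : IsTailFunction β ρ ρ') (z : ℝ) (hz : 0 < z) :
    1 - z ≤ tailInv ρ z ∧ (∀ u, 0 ≤ u → u < tailInv ρ z → z < ρ u) ∧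
    ∀ z', z ≤ z' → tailInv ρ z' ≤ tailInv ρ z := by
  have hb : ∀ z, BddBelow {u : ℝ | 0 ≤ u ∧ ρ u ≤ z} := fun z => ⟨0, fun u hu => hu.1⟩
  have hne : {u : ℝ | 0 ≤ u ∧ ρ u ≤ z}.Nonempty := by
    have := (hρ.tendsto_zero.eventually (gt_mem_nhds hz)).and (eventually_ge_atTop 0)
    obtain ⟨u, hu, hu0⟩ := this.exists
    exact ⟨u, hu0, hu.le⟩
  refine ⟨?_, ?_, ?_⟩
  · refine le_csInf hne ?_
    rintro u ⟨hu0, hu⟩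
    have h2 := hρ.lipschitz 0 le_rfl u hu0
    have h3 := le_abs_self (ρ 0 - ρ u)
    rw [zero_sub, abs_neg, abs_of_nonneg hu0] at h2
    linarith [hρ.one_le]
  · intro u hu0 hu
    by_contra h
    exact absurd (csInf_le (hb z) ⟨hu0, not_lt.1 h⟩) (not_le.2 hu)
  · intro z' hz'
    exact csInf_le_csInf (hb z') hne fun u hu => ⟨hu.1, hu.2.trans hz'⟩

lemma two_point_integral {α : Type*} [MeasurableSpace α] [MeasurableSingletonClass α]
    (p : ℝ) (hp0 : 0 ≤ p) (hp1 : p ≤ 1) (a b : α) (f : α → ℝ) :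
    ∫ z, f z ∂(ENNReal.ofReal (1 - p) • Measure.dirac a + ENNReal.ofReal p • Measure.dirac b)
      = (1 - p) * f a + p * f b := by
  rw [integral_add_measure, integral_smul_measure, integral_smul_measure, integral_dirac,
    integral_dirac, ENNReal.toReal_ofReal (by linarith), ENNReal.toReal_ofReal hp0]
  · rfl
  · exact (integrable_dirac (by simp)).smul_measure ENNReal.ofReal_ne_top
  · exact (integrable_dirac (by simp)).smul_measure ENNReal.ofReal_ne_top

set_option maxHeartbeats 2000000 in
/-- lower bound `Ω(ρ⁻¹(16ε/k)²/(γ²ηT))` on the expected population risk of the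
`T`-th GD iterate, for the two-point hard distribution and the linearly-extended tail loss. -/
theorem statement17 {k n : ℕ} [NeZero k] (hk : 2 ≤ k) (hn : 1 ≤ n)
    (β : ℝ) (hβ : 0 < β) (ρ ρ' : ℝ → ℝ) (hρ : IsTailFunction β ρ ρ')
    (γ : ℝ) (hγ0 : 0 < γ) (hγ : γ ≤ 1 / 8)
    (T : ℕ) (hT : 1 ≤ T)
    (η : ℝ) (hη0 : 0 < η) (hη : η ≤ 1 / (6 * β * k))
    (ε : ℝ) (hε0 : 0 < ε) (hε1 : ε ≤ 1 / 16)
    (hεT : tailInv ρ (ε / k) ^ 2 / (γ ^ 2 * η * T) ≤ ε)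
    (p₀ : ℝ) (hp₀ : p₀ = tailInv ρ (16 * ε / k) / (72 * γ ^ 2 * T * k * η))
    (φ : ℝ → ℝ) (hφ : φ = fun x => if 0 ≤ x then ρ x else ρ 0 + ρ' 0 * x)
    (D : Measure ((Fin 2 → ℝ) × Fin k)) [IsProbabilityMeasure D]
    (hD : D = ENNReal.ofReal (1 - p₀) • Measure.dirac (![1, 0], 0)
        + ENNReal.ofReal p₀ • Measure.dirac (![-(1 / 2), 3 * γ], 0)) :
    tailInv ρ (16 * ε / k) ^ 2 / (5000 * γ ^ 2 * η * T) ≤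
      ∫ ω : Fin n → (Fin 2 → ℝ) × Fin k,
        (∫ z, mcLoss φ (fun r => ∑ t, gdFrom η (empRisk φ ω) (T - 1) r t * z.1 t) z.2 ∂D)
        ∂(Measure.pi fun _ : Fin n => D) := by
  set R := tailInv ρ (16 * ε / k) with hR
  have hk' : (2 : ℝ) ≤ k := by exact_mod_cast hk
  have hT' : (1 : ℝ) ≤ T := by exact_mod_cast hT
  have hn' : (1 : ℝ) ≤ n := by exact_mod_cast hn
  have hz : 0 < 16 * ε / k := by positivity
  have hz1 : 16 * ε / k ≤ 1 / 2 := by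
    rw [div_le_iff₀ (by linarith)]; linarith
  obtain ⟨hRlow, hRlt, -⟩ := tailInv_facts hρ (16 * ε / k) hz
  have hRR : R ≤ tailInv ρ (ε / k) :=
    (tailInv_facts hρ (ε / k) (by positivity)).2.2 _
      (by gcongr; linarith)
  rw [← hR] at hRlow hRlt
  have hR2 : 1 / 2 ≤ R := by linarith
  have hA : 0 < γ ^ 2 * η * T := by positivity
  have hRε : R ^ 2 / (γ ^ 2 * η * T) ≤ ε :=
    le_trans (by gcongr) hεT
  have hRε' : R ^ 2 ≤ ε * (γ ^ 2 * η * T) := by rwa [div_le_iff₀ hA] at hRε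
  have hpe : p₀ * (72 * γ ^ 2 * T * k * η) = R := by
    rw [hp₀]; field_simp
  have hp0 : 0 < p₀ := by rw [hp₀]; positivity
  have hpkR : p₀ * k * R ≤ ε / 72 := by
    have : p₀ * k * R = R ^ 2 / (γ ^ 2 * η * T) / 72 := by
      rw [hp₀]; field_simp
    rw [this]; linarith
  have hp1 : p₀ ≤ 1 / 16 := by nlinarith [mul_le_mul hk' hR2 (by norm_num) (by linarith)]
  set c := -ρ' 0 with hc
  obtain ⟨hd0, hd1⟩ := tail_deriv_nonpos hρ 0 le_rfl
  have hc1 : c ≤ 1 := by linarith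
  have hc2 : 1 / 2 ≤ c := by
    have := hρ.deriv_zero
    rwa [abs_of_nonpos hd0] at this
  have htan : ∀ x, 1 - c * x ≤ φ x := by
    intro x
    rw [hφ]
    dsimp only
    split_ifs with h
    · linarith [tail_tangent hρ x h, hρ.one_le]
    · linarith [hρ.one_le]
  have hφ0 : ∀ x, 0 ≤ φ x := by
    intro x
    by_cases h : 0 ≤ x
    · rw [hφ]; simpa [h] using hρ.nonneg x h
    · nlinarith [htan x]
  have hφR : ∀ x, x < R → 16 * ε / k ≤ φ x := by
    intro x hx
    by_cases h : 0 ≤ x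
    · rw [hφ]; simpa [h] using (hRlt x h hx).le
    · nlinarith [htan x]
  have hder : ∀ x, HasDerivAt φ (if 0 ≤ x then ρ' x else ρ' 0) x := by
    intro x; rw [hφ]; exact phi_hasDeriv hρ x
  have hint : ∀ f : (Fin 2 → ℝ) × Fin k → ℝ, ∫ z, f z ∂D =
      (1 - p₀) * f (![1, 0], 0) + p₀ * f (![-(1 / 2), 3 * γ], 0) := by
    intro f
    rw [hD]
    exact two_point_integral p₀ hp0.le (by linarith) _ _ f
  have hsupp : ∀ᵐ z ∂D, z ∈ ({(![1, 0], 0), (![-(1 / 2), 3 * γ], 0)} :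
      Set ((Fin 2 → ℝ) × Fin k)) := by
    rw [hD, ae_add_measure_iff]
    exact ⟨Measure.ae_smul_measure (by simp [ae_dirac_eq]) _,
      Measure.ae_smul_measure (by simp [ae_dirac_eq]) _⟩
  have hsuppω : ∀ᵐ ω ∂(Measure.pi fun _ : Fin n => D), ω ∈ Set.pi Set.univ (fun _ : Fin n =>
      ({(![1, 0], 0), (![-(1 / 2), 3 * γ], 0)} : Set ((Fin 2 → ℝ) × Fin k))) := by
    have : ∀ i : Fin n, ∀ᵐ ω ∂(Measure.pi fun _ : Fin n => D), ω i ∈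
        ({(![1, 0], 0), (![-(1 / 2), 3 * γ], 0)} : Set ((Fin 2 → ℝ) × Fin k)) := fun i =>
      (Measure.tendsto_eval_ae_ae (μ := fun _ : Fin n => D) (i := i)).eventually hsupp
    filter_upwards [ae_all_iff.2 this] with ω hω i _ using hω i
  have hintegrable : ∀ f : (Fin n → (Fin 2 → ℝ) × Fin k) → ℝ,
      Integrable f (Measure.pi fun _ : Fin n => D) := by
    intro f
    rw [← Measure.restrict_eq_self_of_ae_mem hsuppω]
    refine IntegrableOn.of_finite (Set.Finite.pi (fun _ => ?_))
    exact Set.toFinite _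
  have hcard : ((Finset.univ \ {(0 : Fin k)}).card : ℝ) = k - 1 := by
    rw [Finset.card_sdiff_of_subset (by simp)]
    simp [Nat.cast_sub (NeZero.one_le : 1 ≤ k)]
  -- pointwise bound
  have hpt : ∀ᵐ ω ∂(Measure.pi fun _ : Fin n => D),
      (k - 1) * (p₀ * c * (R / 2 - 3 * γ * (η * k * T) * ((1 / n : ℝ) * ∑ i, (ω i).1 1))) ≤
      ∫ z, mcLoss φ (fun r => ∑ t, gdFrom η (empRisk φ ω) (T - 1) r t * z.1 t) z.2 ∂D := by
    filter_upwards [hsuppω] with ω hω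
    have hω2 : ∀ i, (ω i).2 = 0 := by
      intro i
      rcases hω i (Set.mem_univ i) with h | h
      · rw [h]
      · rw [Set.mem_singleton_iff.1 h]
    have hω1 : ∀ i, 0 ≤ (ω i).1 1 := by
      intro i
      rcases hω i (Set.mem_univ i) with h | h
      · rw [h]; simp
      · rw [Set.mem_singleton_iff.1 h]; simp [hγ0.le]
    rw [hint]
    set v := (1 / n : ℝ) * ∑ i, (ω i).1 1 with hv
    have hv0 : 0 ≤ v := mul_nonneg (by positivity) (Finset.sum_nonneg fun i _ => hω1 i)
    have hgd := gd_bound φ _ hder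
      (by intro x; split_ifs with h; exacts [(tail_deriv_nonpos hρ x h).1, hd0])
      (by intro x; split_ifs with h; exacts [(tail_deriv_nonpos hρ x h).2, hd1])
      η hη0 ω hω2 hω1
    set W := gdFrom η (empRisk φ ω) (T - 1) with hW
    simp only [mcLoss]
    rw [Finset.mul_sum, Finset.mul_sum, ← Finset.sum_add_distrib, ← hcard, ← nsmul_eq_mul]
    refine Finset.card_nsmul_le_sum _ _ _ ?_
    intro j hj
    have hj0 : j ≠ 0 := by simpa using hj
    have hb := hgd j hj0 (T - 1)
    rw [← hW, ← hv] at hb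
    simp only [Fin.sum_univ_two]
    simp only [Matrix.cons_val_zero, Matrix.cons_val_one]
    have hb' : W 0 1 - W j 1 ≤ η * k * T * v := by
      refine hb.trans ?_
      have h1 : ((T - 1 : ℕ) : ℝ) ≤ T := by exact_mod_cast Nat.sub_le T 1
      calc ((T - 1 : ℕ) : ℝ) * (η * k * v) ≤ T * (η * k * v) := by gcongr
        _ = _ := by ring
    have hx : 0 ≤ 3 * γ * (η * k * T) * v := by positivity
    by_cases ha : W 0 0 - W j 0 < R
    · have h1 := hφR _ ha
      have h2 : p₀ * R / 2 ≤ (1 - p₀) * (16 * ε / k) := by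
        have : 15 / 16 * (16 * ε / k) ≤ (1 - p₀) * (16 * ε / k) :=
          mul_le_mul_of_nonneg_right (by linarith) hz.le
        have h3 : p₀ * R ≤ ε / 72 / k := by
          rw [le_div_iff₀ (by linarith)]; linarith
        have h4 : 0 < ε / k := by positivity
        have h5 : ε / 72 / k = ε / k / 72 := by ring
        have h6 : 16 * ε / k = 16 * (ε / k) := by ring
        rw [h6] at this ⊢
        linarith
      have h3 : (1 - p₀) * (16 * ε / k) ≤ (1 - p₀) *
          φ (W 0 0 * 1 + W 0 1 * 0 - (W j 0 * 1 + W j 1 * 0)) := by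
        refine mul_le_mul_of_nonneg_left ?_ (by linarith)
        have e : W 0 0 * 1 + W 0 1 * 0 - (W j 0 * 1 + W j 1 * 0) = W 0 0 - W j 0 := by ring
        rw [e]; exact h1
      have h4 : 0 ≤ p₀ * φ (W 0 0 * -(1 / 2) + W 0 1 * (3 * γ) -
          (W j 0 * -(1 / 2) + W j 1 * (3 * γ))) := mul_nonneg hp0.le (hφ0 _)
      have h5 : p₀ * c * (R / 2 - 3 * γ * (η * k * T) * v) ≤ p₀ * R / 2 := by
        have e1 : 0 ≤ p₀ * c * (3 * γ * (η * k * T) * v) := by positivity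
        have e2 : c * (p₀ * R / 2) ≤ 1 * (p₀ * R / 2) := by
          apply mul_le_mul_of_nonneg_right hc1; positivity
        linarith
      linarith
    · have h3 : 0 ≤ (1 - p₀) *
          φ (W 0 0 * 1 + W 0 1 * 0 - (W j 0 * 1 + W j 1 * 0)) :=
        mul_nonneg (by linarith) (hφ0 _)
      have h4 := htan (W 0 0 * -(1 / 2) + W 0 1 * (3 * γ) -
          (W j 0 * -(1 / 2) + W j 1 * (3 * γ)))
      have h5 : c * (R / 2 - 3 * γ * (η * k * T) * v) ≤ c * (-(W 0 0 * -(1 / 2) + W 0 1 * (3 * γ) -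
          (W j 0 * -(1 / 2) + W j 1 * (3 * γ)))) := by
        refine mul_le_mul_of_nonneg_left ?_ (by linarith)
        have e := mul_le_mul_of_nonneg_left hb' (by positivity : 0 ≤ 3 * γ)
        have ha' := not_lt.1 ha
        linarith
      have h6 := mul_le_mul_of_nonneg_left (show c * (R / 2 - 3 * γ * (η * k * T) * v) ≤
        φ (W 0 0 * -(1 / 2) + W 0 1 * (3 * γ) -
          (W j 0 * -(1 / 2) + W j 1 * (3 * γ))) by linarith) hp0.le
      linarith
  have hEi : ∀ i : Fin n, ∫ ω, (ω i).1 1 ∂(Measure.pi fun _ : Fin n => D) = p₀ * (3 * γ) := by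
    intro i
    rw [integral_comp_eval (μ := fun _ : Fin n => D) (i := i)
      (f := fun z : (Fin 2 → ℝ) × Fin k => z.1 1), hint]
    · simp
    · exact (by fun_prop : Measurable fun z : (Fin 2 → ℝ) × Fin k => z.1 1).aestronglyMeasurable
  refine le_trans ?_ (integral_mono_ae (hintegrable _) (hintegrable _) hpt)
  rw [integral_const_mul, integral_const_mul, integral_sub (hintegrable _) (hintegrable _),
    integral_const_mul, integral_const_mul, integral_finsetSum _ (fun i _ => hintegrable _)]
  simp only [hEi]
  simp only [integral_const, probReal_univ, Finset.sum_const, Finset.card_univ, Fintype.card_fin,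
    nsmul_eq_mul, one_smul]
  have e1 : (1 / n : ℝ) * (n * (p₀ * (3 * γ))) = p₀ * (3 * γ) := by field_simp
  rw [e1]
  have e2 : 3 * γ * (η * k * T) * (p₀ * (3 * γ)) = R / 8 := by
    rw [← hpe]; ring
  rw [e2]
  have e3 : R ^ 2 / (5000 * γ ^ 2 * η * T) = 72 / 5000 * (p₀ * k * R) := by
    rw [hp₀]; field_simp
  rw [e3]
  have hpR : 0 < p₀ * R := by positivity
  have e4 : (k : ℝ) / 2 * (1 / 2) ≤ (k - 1) * c :=
    mul_le_mul (by linarith) hc2 (by norm_num) (by linarith)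
  have e5 := mul_le_mul_of_nonneg_right e4 hpR.le
  have e6 : 0 < (k : ℝ) * (p₀ * R) := by positivity
  nlinarith
end
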